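/- The Grigorchuk group 𝒢 is self-replicating: for every finite binary word w ∈ X* and every g ∈ 𝒢 there exists h ∈ 𝒢 such that h(w) = w and h(w·u) = w·g(u) for all u ∈ X* (i.e., h fixes w and its section at w equals g). -/

import Mathlib

/-- The Grigorchuk generator `a` on finite binary words: flips the first letter. -/
def aMap : List Bool → List Bool
  | [] => []
  | x :: w => (!x) :: w

theorem aMap_invol : ∀ w, aMap (aMap w) = w
  | [] => rfl
  | x :: w => by cases x <;> rfl

mutual
  /-- The Grigorchuk generator `b`: `b(∅)=∅`, `b(0w)=0·a(w)`, `b(1w)=1·c(w)`. -/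
  def bMap : List Bool → List Bool
    | [] => []
    | false :: w => false :: aMap w
    | true :: w => true :: cMap w
  /-- The Grigorchuk generator `c`: `c(∅)=∅`, `c(0w)=0·a(w)`, `c(1w)=1·d(w)`. -/
  def cMap : List Bool → List Bool
    | [] => []
    | false :: w => false :: aMap w
    | true :: w => true :: dMap w
  /-- The Grigorchuk generator `d`: `d(∅)=∅`, `d(0w)=0·w`, `d(1w)=1·b(w)`. -/
  def dMap : List Bool → List Bool
    | [] => []
    | false :: w => false :: w
    | true :: w => true :: bMap w
end

theorem bcd_invol : ∀ w : List Bool,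
    bMap (bMap w) = w ∧ cMap (cMap w) = w ∧ dMap (dMap w) = w := by
  intro w
  induction w with
  | nil => exact ⟨rfl, rfl, rfl⟩
  | cons x w ih =>
    cases x <;>
      simp [bMap, cMap, dMap, aMap_invol, ih.1, ih.2.1, ih.2.2]

/-- `a` as a permutation of the set of finite binary words. -/
def aPerm : Equiv.Perm (List Bool) := ⟨aMap, aMap, aMap_invol, aMap_invol⟩

/-- `b` as a permutation of the set of finite binary words. -/
def bPerm : Equiv.Perm (List Bool) :=
  ⟨bMap, bMap, fun w => (bcd_invol w).1, fun w => (bcd_invol w).1⟩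

/-- `c` as a permutation of the set of finite binary words. -/
def cPerm : Equiv.Perm (List Bool) :=
  ⟨cMap, cMap, fun w => (bcd_invol w).2.1, fun w => (bcd_invol w).2.1⟩

/-- `d` as a permutation of the set of finite binary words. -/
def dPerm : Equiv.Perm (List Bool) :=
  ⟨dMap, dMap, fun w => (bcd_invol w).2.2, fun w => (bcd_invol w).2.2⟩

/-- The Grigorchuk group: the group of bijections of `X*` generated by `a, b, c, d`. -/
def Grig : Subgroup (Equiv.Perm (List Bool)) :=
  Subgroup.closure {aPerm, bPerm, cPerm, dPerm}

theorem grig_nil (g : Equiv.Perm (List Bool)) (hg : g ∈ Grig) : g [] = [] := by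
  unfold Grig at hg
  induction hg using Subgroup.closure_induction with
  | mem x hx =>
    simp only [Set.mem_insert_iff, Set.mem_singleton_iff] at hx
    rcases hx with rfl | rfl | rfl | rfl <;> rfl
  | one => rfl
  | mul x y _ _ hx hy => rw [Equiv.Perm.mul_apply, hy, hx]
  | inv x _ hx => rw [Equiv.Perm.inv_eq_iff_eq, hx]

theorem aPerm_mem : aPerm ∈ Grig := Subgroup.subset_closure (by simp)
theorem bPerm_mem : bPerm ∈ Grig := Subgroup.subset_closure (by simp)
theorem cPerm_mem : cPerm ∈ Grig := Subgroup.subset_closure (by simp)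
theorem dPerm_mem : dPerm ∈ Grig := Subgroup.subset_closure (by simp)

theorem conj_mem {x : Equiv.Perm (List Bool)} (hx : x ∈ Grig) : aPerm * x * aPerm ∈ Grig :=
  Grig.mul_mem (Grig.mul_mem aPerm_mem hx) aPerm_mem

/-- Self-replication at a single letter. -/
theorem grig_letter (x : Bool) (g : Equiv.Perm (List Bool)) (hg : g ∈ Grig) :
    ∃ h ∈ Grig, ∀ u : List Bool, h (x :: u) = x :: g u := by
  unfold Grig at hg
  induction hg using Subgroup.closure_induction with
  | mem y hy =>
    simp only [Set.mem_insert_iff, Set.mem_singleton_iff] at hy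
    cases x
    · rcases hy with rfl | rfl | rfl | rfl
      · exact ⟨bPerm, bPerm_mem, fun u => by simp [aPerm, bPerm, bMap]⟩
      · exact ⟨_, conj_mem dPerm_mem, fun u => by simp [aPerm, bPerm, dPerm, aMap, dMap]⟩
      · exact ⟨_, conj_mem bPerm_mem, fun u => by simp [aPerm, bPerm, cPerm, aMap, bMap]⟩
      · exact ⟨_, conj_mem cPerm_mem, fun u => by simp [aPerm, cPerm, dPerm, aMap, cMap]⟩
    · rcases hy with rfl | rfl | rfl | rfl
      · exact ⟨_, conj_mem bPerm_mem, fun u => by simp [aPerm, bPerm, aMap, bMap]⟩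
      · exact ⟨dPerm, dPerm_mem, fun u => by simp [bPerm, dPerm, dMap]⟩
      · exact ⟨bPerm, bPerm_mem, fun u => by simp [bPerm, cPerm, bMap]⟩
      · exact ⟨cPerm, cPerm_mem, fun u => by simp [cPerm, dPerm, cMap]⟩
  | one => exact ⟨1, Grig.one_mem, fun u => rfl⟩
  | mul y z _ _ hy hz =>
    obtain ⟨h, hm, hh⟩ := hy
    obtain ⟨k, km, hk⟩ := hz
    exact ⟨h * k, Grig.mul_mem hm km, fun u => by
      rw [Equiv.Perm.mul_apply, hk, hh, Equiv.Perm.mul_apply]⟩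
  | inv y _ hy =>
    obtain ⟨h, hm, hh⟩ := hy
    exact ⟨h⁻¹, Grig.inv_mem hm, fun u => by
      rw [Equiv.Perm.inv_eq_iff_eq, hh]; simp⟩

/-- The Grigorchuk group `𝒢` is self-replicating: for every finite binary word `w`
and every `g ∈ 𝒢` there is an `h ∈ 𝒢` with `h(w) = w` and `h(w·u) = w·g(u)` for all
finite binary words `u` (i.e. `h` fixes `w` and its section at `w` equals `g`). -/
theorem grigorchuk_self_replicating :
    ∀ (w : List Bool) (g : Equiv.Perm (List Bool)), g ∈ Grig →
      ∃ h ∈ Grig, h w = w ∧ ∀ u : List Bool, h (w ++ u) = w ++ g u := by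
  intro w g hg
  have key : ∃ h ∈ Grig, ∀ u : List Bool, h (w ++ u) = w ++ g u := by
    induction w with
    | nil => exact ⟨g, hg, fun u => rfl⟩
    | cons x w ih =>
      obtain ⟨h, hm, hh⟩ := ih
      obtain ⟨k, km, hk⟩ := grig_letter x h hm
      exact ⟨k, km, fun u => by rw [List.cons_append, hk, hh, List.cons_append]⟩
  obtain ⟨h, hm, hh⟩ := key
  refine ⟨h, hm, ?_, hh⟩
  have h0 := hh []
  rwa [grig_nil g hg, List.append_nil] at h0
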